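/- arXiv:2407.05904 — 2 statements merged into one kernel-verified Lean document; each statement's English description precedes it below -/
import Mathlib

section
/- Fix u, w ∈ Sₙ, k₁, k₂ ∈ [n-1], and d₁, d₂ ∈ ℤ_{≥0}. The number of permutations v such that there is an increasing k₁-chain of length d₁ from u to v and an increasing k₂-chain of length d₂ from v to w equals the number of permutations v' such that there is an increasing k₂-chain of length d₂ from u to v' and an increasing k₁-chain of length d₁ from v' to w. -/
/-- Number of inversions of a permutation of `Fin n`. -/
def invCount {n : ℕ} (w : Equiv.Perm (Fin n)) : ℕ :=
  (Finset.univ.filter (fun p : Fin n × Fin n => p.1 < p.2 ∧ w p.2 < w p.1)).card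

/-- `w ∈ Sₙ^{k↘}` (1-indexed: `w(k+1) > ⋯ > w(n)`); positions are 0-indexed here. -/
def DescFrom (n k : ℕ) (w : Equiv.Perm (Fin n)) : Prop :=
  ∀ p q : Fin n, k ≤ (p : ℕ) → p < q → w q < w p

/-- `u ⋖ₖ w` : cover in the `k`-Bruhat order (1-indexed `k`; positions 0-indexed,
so `i ≤ k < j` becomes `↑i < k ≤ ↑j`). -/
def kCover (n k : ℕ) (u w : Equiv.Perm (Fin n)) : Prop :=
  ∃ i j : Fin n, (i : ℕ) < k ∧ k ≤ (j : ℕ) ∧ u = w * Equiv.swap i j ∧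
    invCount w = invCount u + 1

/-- An increasing `k`-chain `v 0 ⋖ₖ v 1 ⋖ₖ ⋯ ⋖ₖ v d`, with
`v m = v (m+1) * swap (a m) (b m)` and strictly increasing smaller swapped values
`v m (a m)`. -/
def IsIncKChain (n k : ℕ) {d : ℕ} (v : Fin (d + 1) → Equiv.Perm (Fin n))
    (a b : Fin d → Fin n) : Prop :=
  (∀ m : Fin d, (a m : ℕ) < k ∧ k ≤ (b m : ℕ) ∧
      v m.castSucc = v m.succ * Equiv.swap (a m) (b m) ∧
      invCount (v m.succ) = invCount (v m.castSucc) + 1) ∧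
  ∀ m m' : Fin d, m < m' → v m.castSucc (a m) < v m'.castSucc (a m')

/-- There is an increasing `k`-chain of length `d` (number of covers) from `u` to `w`. -/
def ExIncKChainLen (n k d : ℕ) (u w : Equiv.Perm (Fin n)) : Prop :=
  ∃ (v : Fin (d + 1) → Equiv.Perm (Fin n)) (a b : Fin d → Fin n),
    IsIncKChain n k v a b ∧ v 0 = u ∧ v (Fin.last d) = w

/-- Combinatorial cover relation: `a < b` and `u * swap a b` covers `u` in the Bruhat order. -/
def BruhatCov {n : ℕ} (u : Equiv.Perm (Fin n)) (a b : Fin n) : Prop :=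
  a < b ∧ u a < u b ∧ ∀ c, a < c → c < b → ¬(u a < u c ∧ u c < u b)

theorem invCount_mul_swap {n : ℕ} (u : Equiv.Perm (Fin n)) {a b : Fin n} (hab : a < b)
    (hu : u a < u b) :
    (invCount (u * Equiv.swap a b) : ℤ) = invCount u + 1 +
      2 * ∑ c : Fin n, (if a < c ∧ c < b ∧ u a < u c ∧ u c < u b then 1 else 0 : ℤ) := by
  have key : ∀ w : Equiv.Perm (Fin n), (invCount w : ℤ) =
      ∑ p : Fin n, ∑ q : Fin n, (if p < q ∧ w q < w p then 1 else 0 : ℤ) := by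
    intro w
    rw [invCount, Finset.card_filter, ← Finset.univ_product_univ, Finset.sum_product]
    push_cast
    rfl
  have re : (invCount (u * Equiv.swap a b) : ℤ) = ∑ p : Fin n, ∑ q : Fin n,
      (if Equiv.swap a b p < Equiv.swap a b q ∧ u q < u p then 1 else 0 : ℤ) := by
    rw [key, ← Equiv.sum_comp (Equiv.swap a b)]
    refine Finset.sum_congr rfl fun p _ => ?_
    rw [← Equiv.sum_comp (Equiv.swap a b)]
    refine Finset.sum_congr rfl fun q _ => ?_
    simp
  have hsplit : ∀ p q : Fin n,
      (if Equiv.swap a b p < Equiv.swap a b q ∧ u q < u p then 1 else 0 : ℤ) =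
      (if p < q ∧ u q < u p then 1 else 0) + (if p = b then if q = a then 1 else 0 else 0)
      + (if q = a then if a < p ∧ p < b ∧ u a < u p then 1 else 0 else 0)
      - (if q = b then if a < p ∧ p < b ∧ u b < u p then 1 else 0 else 0)
      + (if p = b then if a < q ∧ q < b ∧ u q < u b then 1 else 0 else 0)
      - (if p = a then if a < q ∧ q < b ∧ u q < u a then 1 else 0 else 0) := by
    intro p q
    rcases eq_or_ne p a with rfl | hpa
    · rcases eq_or_ne q p with rfl | hqa
      · simp
        grind
      · rcases eq_or_ne q b with rfl | hqb
        · simp; grind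
        · rw [Equiv.swap_apply_left, Equiv.swap_apply_of_ne_of_ne hqa hqb]
          grind
    · rcases eq_or_ne p b with rfl | hpb
      · rcases eq_or_ne q a with rfl | hqa
        · simp; grind
        · rcases eq_or_ne q p with rfl | hqb
          · simp; grind
          · rw [Equiv.swap_apply_right, Equiv.swap_apply_of_ne_of_ne hqa hqb]
            grind
      · rw [Equiv.swap_apply_of_ne_of_ne hpa hpb]
        rcases eq_or_ne q a with rfl | hqa
        · simp; grind
        · rcases eq_or_ne q b with rfl | hqb
          · simp; grind
          · rw [Equiv.swap_apply_of_ne_of_ne hqa hqb]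
            grind
  have hfin : ∀ c : Fin n, (if a < c ∧ c < b ∧ u a < u c then 1 else 0 : ℤ)
      - (if a < c ∧ c < b ∧ u b < u c then 1 else 0)
      + (if a < c ∧ c < b ∧ u c < u b then 1 else 0)
      - (if a < c ∧ c < b ∧ u c < u a then 1 else 0) =
      2 * (if a < c ∧ c < b ∧ u a < u c ∧ u c < u b then 1 else 0) := by
    intro c
    by_cases h1 : a < c
    · by_cases h2 : c < b
      · have h3 : u a ≠ u c := fun h => h1.ne (u.injective h)
        have h4 : u c ≠ u b := fun h => h2.ne (u.injective h)
        grind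
      · simp [h2]
    · simp [h1]
  rw [re, key]
  simp only [hsplit, Finset.sum_add_distrib, Finset.sum_sub_distrib]
  rw [Finset.mul_sum, ← Finset.sum_congr rfl (fun c _ => hfin c)]
  simp only [Finset.sum_add_distrib, Finset.sum_sub_distrib]
  have s1 : ∀ (x : Fin n) (F : Fin n → ℤ), ∑ p, ∑ q, (if p = x then F q else 0) = ∑ q, F q := by
    intro x F
    rw [Finset.sum_comm]
    simp
  simp only [s1, Finset.sum_ite_eq', Finset.mem_univ, if_true]
  ring

theorem bruhatCov_iff {n : ℕ} (u : Equiv.Perm (Fin n)) {a b : Fin n} (hab : a < b) :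
    BruhatCov u a b ↔ invCount (u * Equiv.swap a b) = invCount u + 1 := by
  rcases lt_trichotomy (u a) (u b) with h | h | h
  · have := invCount_mul_swap u hab h
    constructor
    · rintro ⟨-, -, h3⟩
      rw [Finset.sum_eq_zero] at this
      · omega
      · intro c _
        rw [if_neg]
        rintro ⟨h4, h5, h6⟩
        exact h3 c h4 h5 h6
    · intro he
      refine ⟨hab, h, fun c h4 h5 h6 => ?_⟩
      have hz : ∑ c : Fin n,
          (if a < c ∧ c < b ∧ u a < u c ∧ u c < u b then 1 else 0 : ℤ) = 0 := by omega
      rw [Finset.sum_eq_zero_iff_of_nonneg (fun i _ => by split_ifs <;> simp)] at hz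
      have := hz c (Finset.mem_univ _)
      rw [if_pos ⟨h4, h5, h6⟩] at this
      exact one_ne_zero this
  · exact absurd (u.injective h) hab.ne
  · have := invCount_mul_swap (u * Equiv.swap a b) hab (by simpa using h)
    rw [mul_assoc, Equiv.swap_mul_self, mul_one] at this
    have h0 : 0 ≤ ∑ c : Fin n, (if a < c ∧ c < b ∧ (u * Equiv.swap a b) a <
      (u * Equiv.swap a b) c ∧ (u * Equiv.swap a b) c < (u * Equiv.swap a b) b
        then 1 else 0 : ℤ) := Finset.sum_nonneg (fun i _ => by split_ifs <;> simp)
    constructor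
    · rintro ⟨-, h2, -⟩
      exact absurd h h2.asymm
    · intro he
      omega

open Classical in
/-- The Bruhat operator attached to the transposition of positions `a` and `b`. -/
noncomputable def bruhatOp {n : ℕ} (a b : Fin n) : Module.End ℤ (Equiv.Perm (Fin n) → ℤ) where
  toFun f u := if BruhatCov u a b then f (u * Equiv.swap a b) else 0
  map_add' f g := by
    ext u
    simp only [Pi.add_apply]
    split_ifs <;> simp
  map_smul' c f := by
    ext u
    simp

open Classical in
theorem bruhatOp_apply {n : ℕ} (a b : Fin n) (f : Equiv.Perm (Fin n) → ℤ)
    (u : Equiv.Perm (Fin n)) :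
    bruhatOp a b f u = if BruhatCov u a b then f (u * Equiv.swap a b) else 0 := rfl

theorem bruhatOp_of_not_lt {n : ℕ} {a b : Fin n} (h : ¬ a < b) : bruhatOp a b = 0 := by
  refine LinearMap.ext fun f => funext fun u => ?_
  rw [bruhatOp_apply, if_neg fun h' => h h'.1]
  rfl

theorem BruhatCov.of_disjoint {n : ℕ} {u : Equiv.Perm (Fin n)} {a b c d : Fin n}
    (hac : a ≠ c) (had : a ≠ d) (hbc : b ≠ c) (hbd : b ≠ d)
    (h1 : BruhatCov u a b) (h2 : BruhatCov (u * Equiv.swap a b) c d) :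
    BruhatCov u c d ∧ BruhatCov (u * Equiv.swap c d) a b := by
  obtain ⟨hab, huab, h1⟩ := h1
  obtain ⟨hcd, hucd, h2⟩ := h2
  have e1 : ∀ e, e ≠ a → e ≠ b → (u * Equiv.swap a b) e = u e := fun e h h' => by
    simp [Equiv.swap_apply_of_ne_of_ne h h']
  have e2 : (u * Equiv.swap a b) a = u b := by simp
  have e3 : (u * Equiv.swap a b) b = u a := by simp
  have e1' : ∀ e, e ≠ c → e ≠ d → (u * Equiv.swap c d) e = u e := fun e h h' => by
    simp [Equiv.swap_apply_of_ne_of_ne h h']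
  have e2' : (u * Equiv.swap c d) c = u d := by simp
  have e3' : (u * Equiv.swap c d) d = u c := by simp
  have inj : ∀ x y, x ≠ y → u x ≠ u y := fun x y h => u.injective.ne h
  rw [e1 c hac.symm hbc.symm, e1 d had.symm hbd.symm] at hucd h2
  have := h2 a
  have := h2 b
  have := h1 c
  have := h1 d
  have := inj a c hac
  have := inj a d had
  have := inj b c hbc
  have := inj b d hbd
  refine ⟨⟨hcd, hucd, fun e he1 he2 => ?_⟩, ⟨hab, ?_, fun e he1 he2 => ?_⟩⟩
  · have := h2 e
    rcases eq_or_ne e a with rfl | hea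
    · grind
    · rcases eq_or_ne e b with rfl | heb
      · grind
      · grind
  · rw [e1' a hac had, e1' b hbc hbd]; exact huab
  · rw [e1' a hac had, e1' b hbc hbd]
    have := h1 e
    rcases eq_or_ne e c with rfl | hea
    · grind
    · rcases eq_or_ne e d with rfl | heb
      · grind
      · grind

theorem bruhatOp_comm {n : ℕ} {a b c d : Fin n}
    (hac : a ≠ c) (had : a ≠ d) (hbc : b ≠ c) (hbd : b ≠ d) :
    bruhatOp a b * bruhatOp c d = bruhatOp c d * bruhatOp a b := by
  refine LinearMap.ext fun f => funext fun u => ?_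
  simp only [Module.End.mul_apply, bruhatOp_apply, ← ite_and]
  have hs : u * Equiv.swap a b * Equiv.swap c d = u * Equiv.swap c d * Equiv.swap a b := by
    rw [mul_assoc, mul_assoc]
    congr 1
    ext1 e
    simp only [Equiv.Perm.mul_apply, Equiv.swap_apply_def]
    grind
  rw [hs]
  congr 1
  exact propext ⟨fun h => h.1.of_disjoint hac had hbc hbd h.2,
    fun h => h.1.of_disjoint hac.symm hbc.symm had.symm hbd.symm h.2⟩

theorem bruhatOp_three_term {n : ℕ} {i j k : Fin n} (hij : i < j) (hjk : j < k) :
    bruhatOp i j * bruhatOp j k = bruhatOp j k * bruhatOp i k + bruhatOp i k * bruhatOp i j := by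
  refine LinearMap.ext fun f => funext fun u => ?_
  simp only [Module.End.mul_apply, LinearMap.add_apply, Pi.add_apply, bruhatOp_apply, ← ite_and]
  have hik := hij.trans hjk
  have s1 : u * Equiv.swap j k * Equiv.swap i k = u * Equiv.swap i j * Equiv.swap j k := by
    rw [mul_assoc, mul_assoc]
    congr 1
    ext1 e
    simp only [Equiv.Perm.mul_apply, Equiv.swap_apply_def]
    grind
  have s2 : u * Equiv.swap i k * Equiv.swap i j = u * Equiv.swap i j * Equiv.swap j k := by
    rw [mul_assoc, mul_assoc]
    congr 1
    ext1 e
    simp only [Equiv.Perm.mul_apply, Equiv.swap_apply_def]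
    grind
  rw [s1, s2]
  have inj : ∀ x y, x ≠ y → u x ≠ u y := fun x y h => u.injective.ne h
  have n1 := inj i j hij.ne
  have n2 := inj j k hjk.ne
  have n3 := inj i k hik.ne
  have hB : BruhatCov (u * Equiv.swap i j) j k ↔
      u i < u k ∧ ∀ c, j < c → c < k → ¬ (u i < u c ∧ u c < u k) := by
    unfold BruhatCov
    simp only [Equiv.Perm.mul_apply, Equiv.swap_apply_def]
    grind
  have hD : BruhatCov (u * Equiv.swap j k) i k ↔ u i < u j ∧ ¬ (u i < u k ∧ u k < u j) ∧
      ∀ c, i < c → c < k → c ≠ j → ¬ (u i < u c ∧ u c < u j) := by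
    unfold BruhatCov
    simp only [Equiv.Perm.mul_apply, Equiv.swap_apply_def]
    grind
  have hF : BruhatCov (u * Equiv.swap i k) i j ↔
      u k < u j ∧ ∀ c, i < c → c < j → ¬ (u k < u c ∧ u c < u j) := by
    unfold BruhatCov
    simp only [Equiv.Perm.mul_apply, Equiv.swap_apply_def]
    grind
  have hP : (BruhatCov u i j ∧ BruhatCov (u * Equiv.swap i j) j k) ↔
      ((BruhatCov u j k ∧ BruhatCov (u * Equiv.swap j k) i k) ∨
        (BruhatCov u i k ∧ BruhatCov (u * Equiv.swap i k) i j)) := by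
    have inj' : ∀ c, c ≠ i → c ≠ j → c ≠ k → u c ≠ u i ∧ u c ≠ u j ∧ u c ≠ u k :=
      fun c h1 h2 h3 => ⟨inj c i h1, inj c j h2, inj c k h3⟩
    rw [hB, hD, hF]
    unfold BruhatCov
    constructor
    · rintro ⟨⟨-, h1, h2⟩, h3, h4⟩
      rcases n2.lt_or_gt with h | h
      · left
        refine ⟨⟨hjk, h, fun c c1 c2 c3 => ?_⟩, h1, ?_, fun c c1 c2 c3 => ?_⟩
        · grind
        · grind
        · grind
      · right
        refine ⟨⟨hik, h3, fun c c1 c2 c3 => ?_⟩, h, fun c c1 c2 c3 => ?_⟩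
        · grind
        · grind
    · rintro (⟨⟨-, h1, h2⟩, h3, h4, h5⟩ | ⟨⟨-, h1, h2⟩, h3, h4⟩)
      · refine ⟨⟨hij, h3, fun c c1 c2 c3 => ?_⟩, h3.trans h1, fun c c1 c2 c3 => ?_⟩
        · grind
        · grind
      · refine ⟨⟨hij, h1.trans h3, fun c c1 c2 c3 => ?_⟩, h1, fun c c1 c2 c3 => ?_⟩
        · grind
        · grind
  have hN : ¬ ((BruhatCov u j k ∧ BruhatCov (u * Equiv.swap j k) i k) ∧
        (BruhatCov u i k ∧ BruhatCov (u * Equiv.swap i k) i j)) := by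
    rw [hF]
    rintro ⟨⟨h1, -⟩, -, h2, -⟩
    exact h2.asymm h1.2.1
  grind

theorem bruhatOp_three_term' {n : ℕ} {i j k : Fin n} (hij : i < j) (hjk : j < k) :
    bruhatOp j k * bruhatOp i j = bruhatOp i j * bruhatOp i k + bruhatOp i k * bruhatOp j k := by
  refine LinearMap.ext fun f => funext fun u => ?_
  simp only [Module.End.mul_apply, LinearMap.add_apply, Pi.add_apply, bruhatOp_apply, ← ite_and]
  have hik := hij.trans hjk
  have s1 : u * Equiv.swap i j * Equiv.swap i k = u * Equiv.swap j k * Equiv.swap i j := by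
    rw [mul_assoc, mul_assoc]
    congr 1
    ext1 e
    simp only [Equiv.Perm.mul_apply, Equiv.swap_apply_def]
    grind
  have s2 : u * Equiv.swap i k * Equiv.swap j k = u * Equiv.swap j k * Equiv.swap i j := by
    rw [mul_assoc, mul_assoc]
    congr 1
    ext1 e
    simp only [Equiv.Perm.mul_apply, Equiv.swap_apply_def]
    grind
  rw [s1, s2]
  have inj : ∀ x y, x ≠ y → u x ≠ u y := fun x y h => u.injective.ne h
  have n1 := inj i j hij.ne
  have n2 := inj j k hjk.ne
  have n3 := inj i k hik.ne
  have hB : BruhatCov (u * Equiv.swap j k) i j ↔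
      u i < u k ∧ ∀ c, i < c → c < j → ¬ (u i < u c ∧ u c < u k) := by
    unfold BruhatCov
    simp only [Equiv.Perm.mul_apply, Equiv.swap_apply_def]
    grind
  have hD : BruhatCov (u * Equiv.swap i j) i k ↔ u j < u k ∧ ¬ (u j < u i ∧ u i < u k) ∧
      ∀ c, i < c → c < k → c ≠ j → ¬ (u j < u c ∧ u c < u k) := by
    unfold BruhatCov
    simp only [Equiv.Perm.mul_apply, Equiv.swap_apply_def]
    grind
  have hF : BruhatCov (u * Equiv.swap i k) j k ↔
      u j < u i ∧ ∀ c, j < c → c < k → ¬ (u j < u c ∧ u c < u i) := by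
    unfold BruhatCov
    simp only [Equiv.Perm.mul_apply, Equiv.swap_apply_def]
    grind
  have hP : (BruhatCov u j k ∧ BruhatCov (u * Equiv.swap j k) i j) ↔
      ((BruhatCov u i j ∧ BruhatCov (u * Equiv.swap i j) i k) ∨
        (BruhatCov u i k ∧ BruhatCov (u * Equiv.swap i k) j k)) := by
    have inj' : ∀ c, c ≠ i → c ≠ j → c ≠ k → u c ≠ u i ∧ u c ≠ u j ∧ u c ≠ u k :=
      fun c h1 h2 h3 => ⟨inj c i h1, inj c j h2, inj c k h3⟩
    rw [hB, hD, hF]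
    unfold BruhatCov
    constructor
    · rintro ⟨⟨-, h1, h2⟩, h3, h4⟩
      rcases n1.lt_or_gt with h | h
      · left
        refine ⟨⟨hij, h, fun c c1 c2 c3 => ?_⟩, h1, ?_, fun c c1 c2 c3 => ?_⟩
        · grind
        · grind
        · grind
      · right
        refine ⟨⟨hik, h3, fun c c1 c2 c3 => ?_⟩, h, fun c c1 c2 c3 => ?_⟩
        · grind
        · grind
    · rintro (⟨⟨-, h1, h2⟩, h3, h4, h5⟩ | ⟨⟨-, h1, h2⟩, h3, h4⟩)
      · refine ⟨⟨hjk, h3, fun c c1 c2 c3 => ?_⟩, h1.trans h3, fun c c1 c2 c3 => ?_⟩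
        · grind
        · grind
      · refine ⟨⟨hjk, h3.trans h1, fun c c1 c2 c3 => ?_⟩, h1, fun c c1 c2 c3 => ?_⟩
        · grind
        · grind
  have hN : ¬ ((BruhatCov u i j ∧ BruhatCov (u * Equiv.swap i j) i k) ∧
        (BruhatCov u i k ∧ BruhatCov (u * Equiv.swap i k) j k)) := by
    rw [hF]
    rintro ⟨⟨h1, -⟩, -, h2, -⟩
    exact h2.asymm h1.2.1
  grind

theorem commute_sum_of_three_term {R ι : Type*} [Ring R] [Fintype ι] [DecidableEq ι]
    (x : ι → ι → R) (hanti : ∀ i j, x j i = -x i j) (hself : ∀ i, x i i = 0)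
    (hcomm : ∀ i j k l, i ≠ k → i ≠ l → j ≠ k → j ≠ l → x i j * x k l = x k l * x i j)
    (hthree : ∀ i j k, i ≠ j → j ≠ k → i ≠ k →
      x i j * x j k + x j k * x k i + x k i * x i j = 0) (i j : ι) :
    Commute (∑ k, x i k) (∑ k, x j k) := by
  rcases eq_or_ne i j with rfl | hij
  · exact Commute.refl _
  rw [commute_iff_eq, ← sub_eq_zero, Finset.sum_mul_sum, Finset.sum_mul_sum,
    Finset.sum_comm (f := fun a b => x j a * x i b), ← Finset.sum_sub_distrib]
  simp only [← Finset.sum_sub_distrib]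
  have hsplit : ∀ k l, x i k * x j l - x j l * x i k =
      (if k = j then x i j * x j l - x j l * x i j else 0)
      + (if l = i then x i k * x j i - x j i * x i k else 0)
      + (if k = l then x i k * x j k - x j k * x i k else 0) := by
    intro k l
    rcases eq_or_ne k j with rfl | hkj
    · rcases eq_or_ne l i with rfl | hli
      · simp [hij.symm, hanti l k]
      · rcases eq_or_ne k l with rfl | hkl
        · simp [hli, hself]
        · simp [hli, hkl]
    · rcases eq_or_ne l i with rfl | hli
      · rcases eq_or_ne k l with rfl | hkl
        · simp [hkj, hself]
        · simp [hkj, hkl]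
      · rcases eq_or_ne k l with rfl | hkl
        · simp [hkj, hli]
        · rcases eq_or_ne k i with rfl | hki
          · simp [hself, hkj, hli]
          · rcases eq_or_ne l j with rfl | hlj
            · simp [hself, hkj, hli]
            · rw [hcomm i k j l hij hli.symm hkj hkl]
              simp [hkj, hli, hkl]
  rw [Finset.sum_congr rfl fun k _ => Finset.sum_congr rfl fun l _ => hsplit k l]
  simp only [Finset.sum_add_distrib]
  rw [Finset.sum_comm (f := fun a b => if a = j then x i j * x j b - x j b * x i j else 0)]
  simp only [Finset.sum_ite_eq, Finset.sum_ite_eq', Finset.mem_univ, if_true]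
  rw [← Finset.sum_add_distrib, ← Finset.sum_add_distrib]
  refine Finset.sum_eq_zero fun k _ => ?_
  rcases eq_or_ne k i with rfl | hki
  · simp [hself, hanti j k]
  rcases eq_or_ne k j with rfl | hkj
  · simp [hself, hanti i k]
  have h1 := hthree i j k hij hkj.symm hki.symm
  have h2 := hthree j i k hij.symm hki.symm hkj.symm
  rw [hanti i k] at h1
  rw [hanti i j, hanti j k] at h2
  rw [hanti i j]
  have h3 := congrArg₂ (· - ·) h1 h2
  simp only [sub_zero] at h3
  rw [← h3]
  noncomm_ring

/-- The type A Dunkl element acting on functions on the symmetric group: multiplication by one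
of the standard generators of the cohomology ring of the flag variety. -/
noncomputable def dunklOp {n : ℕ} (j : Fin n) : Module.End ℤ (Equiv.Perm (Fin n) → ℤ) :=
  ∑ c, (bruhatOp j c - bruhatOp c j)

theorem dunklOp_commute {n : ℕ} (i j : Fin n) : Commute (dunklOp i) (dunklOp j) := by
  refine commute_sum_of_three_term (fun i j => bruhatOp i j - bruhatOp j i)
    (fun i j => (neg_sub _ _).symm) (fun i => sub_self _) ?_ ?_ i j
  · intro i j k l hik hil hjk hjl
    simp only [sub_mul, mul_sub]
    rw [bruhatOp_comm hik hil hjk hjl, bruhatOp_comm hil hik hjl hjk,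
      bruhatOp_comm hjk hjl hik hil, bruhatOp_comm hjl hjk hil hik]
    abel
  · have h0 : ∀ {a b : Fin n}, a < b → bruhatOp b a = 0 := fun h => bruhatOp_of_not_lt h.asymm
    intro i j k hij hjk hik
    rcases hij.lt_or_gt with h1 | h1 <;> rcases hjk.lt_or_gt with h2 | h2 <;>
      rcases hik.lt_or_gt with h3 | h3
    · rw [h0 h1, h0 h2, h0 h3]
      have := bruhatOp_three_term h1 h2
      simp [this]
    · exact absurd (h1.trans h2) h3.asymm
    · rw [h0 h1, h0 h2, h0 h3]
      have := bruhatOp_three_term' h3 h2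
      simp [this]
    · rw [h0 h1, h0 h2, h0 h3]
      have := bruhatOp_three_term h3 h1
      simp [this]
      abel
    · rw [h0 h1, h0 h2, h0 h3]
      have := bruhatOp_three_term' h1 h3
      simp [this]
      abel
    · rw [h0 h1, h0 h2, h0 h3]
      have := bruhatOp_three_term h2 h3
      simp [this]
    · exact absurd (h3.trans h2) h1.asymm
    · rw [h0 h1, h0 h2, h0 h3]
      have := bruhatOp_three_term' h2 h1
      simp [this]

open Classical in
/-- Restriction of functions on the symmetric group to the permutations satisfying `S`. -/
noncomputable def restrictOp {n : ℕ} (S : Equiv.Perm (Fin n) → Prop) :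
    Module.End ℤ (Equiv.Perm (Fin n) → ℤ) where
  toFun f u := if S u then f u else 0
  map_add' f g := by
    ext u
    simp only [Pi.add_apply]
    split_ifs <;> simp
  map_smul' c f := by
    ext u
    simp

theorem restrictOp_apply {n : ℕ} (S : Equiv.Perm (Fin n) → Prop) (f : Equiv.Perm (Fin n) → ℤ)
    (u : Equiv.Perm (Fin n)) [Decidable (S u)] :
    restrictOp S f u = if S u then f u else 0 := by
  by_cases h : S u <;> simp [restrictOp, h]

/-- The summand of `dunklOp j` exchanging positions `j` and `c`, restricted to the exchanges
whose smaller value is at least `p`. -/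
noncomputable def dunklTerm {n : ℕ} (j : Fin n) (p : ℕ) (c : Fin n) :
    Module.End ℤ (Equiv.Perm (Fin n) → ℤ) :=
  restrictOp (fun u => p ≤ (u j : ℕ)) * bruhatOp j c -
    restrictOp (fun u => p ≤ (u c : ℕ)) * bruhatOp c j

theorem dunklTerm_apply {n : ℕ} (j : Fin n) (p : ℕ) (c : Fin n) (f : Equiv.Perm (Fin n) → ℤ)
    (u : Equiv.Perm (Fin n)) : dunklTerm j p c f u =
      (if p ≤ (u j : ℕ) then bruhatOp j c f u else 0) -
        (if p ≤ (u c : ℕ) then bruhatOp c j f u else 0) := by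
  simp only [dunklTerm, LinearMap.sub_apply, Pi.sub_apply, Module.End.mul_apply, restrictOp_apply]

/-- The part of `dunklOp j` exchanging pairs of values whose smaller one is at least `p`. -/
noncomputable def dunklFrom {n : ℕ} (j : Fin n) (p : ℕ) :
    Module.End ℤ (Equiv.Perm (Fin n) → ℤ) :=
  ∑ c, dunklTerm j p c

theorem dunklFrom_apply {n : ℕ} (j : Fin n) (p : ℕ) (f : Equiv.Perm (Fin n) → ℤ)
    (u : Equiv.Perm (Fin n)) : dunklFrom j p f u = ∑ c, dunklTerm j p c f u := by
  simp only [dunklFrom, LinearMap.sum_apply, Finset.sum_apply]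

theorem dunklFrom_zero {n : ℕ} (j : Fin n) : dunklFrom j 0 = dunklOp j := by
  refine LinearMap.ext fun f => funext fun u => ?_
  simp [dunklFrom_apply, dunklTerm_apply, dunklOp]

theorem dunklFrom_of_le {n : ℕ} (j : Fin n) {p : ℕ} (hp : n ≤ p) : dunklFrom j p = 0 := by
  refine LinearMap.ext fun f => funext fun u => ?_
  have h : ∀ c, ¬ p ≤ (u c : ℕ) := fun c => by have := (u c).isLt; omega
  simp [dunklFrom_apply, dunklTerm_apply, h]

/-- Sum over the covers in the `k`-Bruhat order whose smaller swapped value is `p`. -/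
noncomputable def rowOp (n k p : ℕ) : Module.End ℤ (Equiv.Perm (Fin n) → ℤ) :=
  ∑ a : Fin n, if (a : ℕ) < k then restrictOp (fun u => (u a : ℕ) = p) *
    ∑ b : Fin n, if k ≤ (b : ℕ) then bruhatOp a b else 0 else 0

theorem rowOp_apply {n k p : ℕ} (f : Equiv.Perm (Fin n) → ℤ) {u : Equiv.Perm (Fin n)}
    {x : Fin n} (hx : (u x : ℕ) = p) :
    rowOp n k p f u =
      if (x : ℕ) < k then ∑ b : Fin n, if k ≤ (b : ℕ) then bruhatOp x b f u else 0 else 0 := by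
  have hpush : ∀ (c : Prop) [Decidable c] (g : Module.End ℤ (Equiv.Perm (Fin n) → ℤ)),
      (if c then g else 0) f u = if c then g f u else 0 := by
    intro c _ g
    split_ifs <;> rfl
  simp only [rowOp, LinearMap.sum_apply, Finset.sum_apply, hpush, Module.End.mul_apply,
    restrictOp_apply]
  rw [Finset.sum_eq_single x]
  · simp only [hx, if_true]
  · intro a _ ha
    have : (u a : ℕ) ≠ p := fun h => ha (u.injective (Fin.ext (h.trans hx.symm)))
    simp [this]
  · simp

theorem rowOp_succ_sub {n : ℕ} (j : Fin n) {p : ℕ} (hp : p < n) :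
    rowOp n (j + 1) p - rowOp n j p = dunklFrom j p - dunklFrom j (p + 1) := by
  refine LinearMap.ext fun f => funext fun u => ?_
  obtain ⟨x, hx⟩ := u.surjective ⟨p, hp⟩
  have hx' : (u x : ℕ) = p := by rw [hx]
  have hxc : ∀ c, (u c : ℕ) = p ↔ c = x := fun c =>
    ⟨fun h => u.injective (Fin.ext (h.trans hx'.symm)), fun h => h ▸ hx'⟩
  have hz : ∀ {a b : Fin n}, ¬ a < b → bruhatOp a b f u = 0 := fun h => by
    rw [bruhatOp_of_not_lt h]; rfl
  simp only [LinearMap.sub_apply, Pi.sub_apply, rowOp_apply f hx', dunklFrom_apply,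
    dunklTerm_apply]
  rw [← Finset.sum_sub_distrib]
  have hterm : ∀ c, (if p ≤ (u j : ℕ) then bruhatOp j c f u else 0) -
        (if p ≤ (u c : ℕ) then bruhatOp c j f u else 0) -
      ((if p + 1 ≤ (u j : ℕ) then bruhatOp j c f u else 0) -
        (if p + 1 ≤ (u c : ℕ) then bruhatOp c j f u else 0)) =
      (if j = x then bruhatOp j c f u else 0) - (if c = x then bruhatOp c j f u else 0) := by
    intro c
    have h1 := hxc j
    have h2 := hxc c
    grind
  rw [Finset.sum_congr rfl fun c _ => hterm c, Finset.sum_sub_distrib]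
  simp only [Finset.sum_ite_eq', Finset.mem_univ, if_true]
  rcases lt_trichotomy x j with h | rfl | h
  · have h1 : (x : ℕ) < j + 1 := by have : (x : ℕ) < j := h; omega
    have h2 : (x : ℕ) < j := h
    rw [if_pos h1, if_pos h2, ← Finset.sum_sub_distrib]
    simp only [h.ne', if_false, Finset.sum_const_zero, zero_sub]
    rw [Finset.sum_eq_single j]
    · simp
    · intro b _ hb
      have : (b : ℕ) ≠ j := fun h => hb (Fin.ext h)
      grind
    · simp
  · simp only [Nat.lt_succ_self, if_true, lt_irrefl, if_false, sub_zero, hz (lt_irrefl x)]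
    refine Finset.sum_congr rfl fun b _ => ?_
    split_ifs with hb
    · rfl
    · exact (hz fun h => hb h).symm
  · have h1 : ¬ (x : ℕ) < j + 1 := by have : (j : ℕ) < x := h; omega
    have h2 : ¬ (x : ℕ) < j := by have : (j : ℕ) < x := h; omega
    rw [if_neg h1, if_neg h2, hz h.asymm]
    simp [h.ne]

theorem bruhatOp_congr {n : ℕ} {a b : Fin n} {f g : Equiv.Perm (Fin n) → ℤ}
    {u : Equiv.Perm (Fin n)}
    (h : BruhatCov u a b → f (u * Equiv.swap a b) = g (u * Equiv.swap a b)) :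
    bruhatOp a b f u = bruhatOp a b g u := by
  classical
  simp only [bruhatOp_apply]
  split_ifs with hc
  · exact h hc
  · rfl

theorem bruhatOp_eq_zero {n : ℕ} {a b : Fin n} {f : Equiv.Perm (Fin n) → ℤ}
    {u : Equiv.Perm (Fin n)} (h : BruhatCov u a b → f (u * Equiv.swap a b) = 0) :
    bruhatOp a b f u = 0 := by
  rw [bruhatOp_congr (g := 0) h, map_zero, Pi.zero_apply]

theorem mul_swap_apply_of_ne {n : ℕ} (u : Equiv.Perm (Fin n)) {a b c : Fin n} (h1 : c ≠ a)
    (h2 : c ≠ b) : (u * Equiv.swap a b) c = u c := by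
  rw [Equiv.Perm.mul_apply, Equiv.swap_apply_of_ne_of_ne h1 h2]

theorem mul_swap_apply_left {n : ℕ} (u : Equiv.Perm (Fin n)) (a b : Fin n) :
    (u * Equiv.swap a b) a = u b := by simp

theorem mul_swap_apply_right {n : ℕ} (u : Equiv.Perm (Fin n)) (a b : Fin n) :
    (u * Equiv.swap a b) b = u a := by simp

theorem bruhatOp_dunklFrom_apply {n : ℕ} {x j b : Fin n} (hxj : x < j) (hjb : j < b)
    (f : Equiv.Perm (Fin n) → ℤ) (u : Equiv.Perm (Fin n)) :
    bruhatOp x b (dunklFrom j ((u x : ℕ) + 1) f) u =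
      ∑ c, if c = x then - bruhatOp x j (bruhatOp j b f) u else
        ((if (u x : ℕ) ≤ (u j : ℕ) then bruhatOp j c (bruhatOp x b f) u else 0) -
        (if (u x : ℕ) ≤ (u c : ℕ) then bruhatOp c j (bruhatOp x b f) u else 0)) := by
  have hxb := hxj.trans hjb
  have hxv : ∀ c, c ≠ x → (u c : ℕ) ≠ u x := fun c hc h => hc (u.injective (Fin.ext h))
  have hzero : ∀ (a c : Fin n) (g : Equiv.Perm (Fin n) → ℤ), ¬ a < c → bruhatOp a c g = 0 :=
    fun a c g h => by rw [bruhatOp_of_not_lt h]; rfl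
  have hL : bruhatOp x b (dunklFrom j ((u x : ℕ) + 1) f) u =
      ∑ c, bruhatOp x b (dunklTerm j ((u x : ℕ) + 1) c f) u := by
    simp only [dunklFrom, LinearMap.sum_apply, map_sum, Finset.sum_apply]
  have hT : ∀ c, bruhatOp x b (dunklTerm j ((u x : ℕ) + 1) c f) u =
      (if (u x : ℕ) < (u j : ℕ) then bruhatOp x b (bruhatOp j c f) u else 0) -
      (if c = x then bruhatOp x b (bruhatOp x j f) u
        else if c = b then 0 else
          if (u x : ℕ) < (u c : ℕ) then bruhatOp x b (bruhatOp c j f) u else 0) := by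
    intro c
    by_cases hcov : BruhatCov u x b
    · classical
      have hlt : (u x : ℕ) < u b := hcov.2.1
      simp only [bruhatOp_apply x b, if_pos hcov, dunklTerm_apply]
      rw [mul_swap_apply_of_ne u hxj.ne' hjb.ne]
      congr 1
      rcases eq_or_ne c x with rfl | hcx
      · rw [mul_swap_apply_left]
        simp [Nat.succ_le_of_lt hlt]
      · rcases eq_or_ne c b with rfl | hcb
        · simp [hcx]
        · rw [mul_swap_apply_of_ne u hcx hcb]
          simp [hcx, hcb]
    · simp [bruhatOp_apply x b, hcov]
  rw [hL, ← sub_eq_zero, ← Finset.sum_sub_distrib]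
  have hrel : bruhatOp x j (bruhatOp j b f) u =
      bruhatOp j b (bruhatOp x b f) u + bruhatOp x b (bruhatOp x j f) u := by
    have := congrFun (LinearMap.congr_fun (bruhatOp_three_term hxj hjb) f) u
    simpa only [Module.End.mul_apply, LinearMap.add_apply, Pi.add_apply] using this
  have hoff : ∀ c, c ≠ x → c ≠ b → bruhatOp x b (bruhatOp j c f) = bruhatOp j c (bruhatOp x b f) ∧
      bruhatOp x b (bruhatOp c j f) = bruhatOp c j (bruhatOp x b f) := by
    intro c h1 h2
    constructor
    · exact LinearMap.congr_fun (bruhatOp_comm hxj.ne h1.symm hjb.ne' h2.symm) f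
    · exact LinearMap.congr_fun (bruhatOp_comm h1.symm hxj.ne h2.symm hjb.ne') f
  rw [Finset.sum_eq_add_of_mem x b (Finset.mem_univ _) (Finset.mem_univ _) hxb.ne]
  · rw [hT, hT, if_pos rfl, if_pos rfl, if_neg hxb.ne', if_neg hxb.ne', if_pos rfl,
      hzero j x f hxj.asymm, hzero b j _ hjb.asymm, map_zero]
    simp only [Pi.zero_apply, ite_self, sub_zero, zero_sub]
    rcases (hxv j hxj.ne').lt_or_gt with h | h
    · have h1 : bruhatOp x j (bruhatOp j b f) u = 0 :=
        bruhatOp_eq_zero fun hc => absurd hc.2.1 (fun h' => absurd h (lt_asymm h'))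
      have h2 : bruhatOp x b (bruhatOp x j f) u = 0 := by
        refine bruhatOp_eq_zero fun hc => bruhatOp_eq_zero fun hc' => ?_
        have h3 := hc'.2.1
        rw [mul_swap_apply_left, mul_swap_apply_of_ne u hxj.ne' hjb.ne] at h3
        have h4 : (u b : ℕ) < u j := h3
        have h5 : (u x : ℕ) < u b := hc.2.1
        omega
      rw [if_neg h.asymm, if_neg h.not_ge, h1, h2]
      simp
    · have h1 : bruhatOp x b (bruhatOp j b f) u = 0 := by
        refine bruhatOp_eq_zero fun hc => bruhatOp_eq_zero fun hc' => ?_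
        have h3 := hc'.2.1
        rw [mul_swap_apply_right, mul_swap_apply_of_ne u hxj.ne' hjb.ne] at h3
        exact absurd h (lt_asymm h3)
      rw [if_pos h, if_pos h.le, h1, hrel]
      ring
  · intro c _ hc
    rw [hT, if_neg hc.1, if_neg hc.1, if_neg hc.2, (hoff c hc.1 hc.2).1, (hoff c hc.1 hc.2).2]
    have h1 := hxv c hc.1
    have h2 := hxv j hxj.ne'
    have e1 : (u x : ℕ) ≤ u c ↔ (u x : ℕ) < u c := by omega
    have e2 : (u x : ℕ) ≤ u j ↔ (u x : ℕ) < u j := by omega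
    simp only [e1, e2, sub_self]

theorem rowOp_mul_dunklFrom {n : ℕ} (j : Fin n) {p : ℕ} (hp : p < n) :
    rowOp n j p * dunklFrom j (p + 1) = dunklFrom j p * rowOp n (j + 1) p := by
  refine LinearMap.ext fun f => funext fun u => ?_
  simp only [Module.End.mul_apply]
  obtain ⟨x, hx⟩ := u.surjective ⟨p, hp⟩
  have hx' : (u x : ℕ) = p := by rw [hx]
  have hxv : ∀ c, c ≠ x → (u c : ℕ) ≠ p :=
    fun c hc h => hc (u.injective (Fin.ext (h.trans hx'.symm)))
  rw [rowOp_apply _ hx', dunklFrom_apply j p (rowOp n (j + 1) p f)]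
  by_cases hxj : x < j
  · have hxj1 : (x : ℕ) < j := hxj
    have hxj2 : (x : ℕ) < j + 1 := by omega
    rw [if_pos hxj1]
    have hL : ∀ b : Fin n, (if (j : ℕ) ≤ (b : ℕ) then
        bruhatOp x b (dunklFrom j (p + 1) f) u else 0) =
        ∑ c, if (j : ℕ) + 1 ≤ (b : ℕ) then
          (if c = x then - bruhatOp x j (bruhatOp j b f) u else
          ((if p ≤ (u j : ℕ) then bruhatOp j c (bruhatOp x b f) u else 0) -
          (if p ≤ (u c : ℕ) then bruhatOp c j (bruhatOp x b f) u else 0))) else 0 := by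
      intro b
      rcases lt_trichotomy j b with h | rfl | h
      · have h1 : (j : ℕ) < b := h
        simp only [if_pos h1.le, if_pos (Nat.succ_le_of_lt h1)]
        subst hx'
        exact bruhatOp_dunklFrom_apply hxj h f u
      · simp only [le_refl, if_true, Nat.not_succ_le_self, if_false, Finset.sum_const_zero]
        refine bruhatOp_eq_zero fun hc => ?_
        rw [dunklFrom_apply]
        refine Finset.sum_eq_zero fun c _ => ?_
        rw [dunklTerm_apply, mul_swap_apply_right, if_neg (by omega), zero_sub, neg_eq_zero]
        split_ifs with hpc
        · refine bruhatOp_eq_zero fun hc' => ?_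
          have h2 := hc'.2.1
          rw [mul_swap_apply_right u x j] at h2
          have h3 : ((u * Equiv.swap x j) c : ℕ) < u x := h2
          omega
        · rfl
      · have h1 : (b : ℕ) < j := h
        simp only [if_neg h1.not_ge, if_neg (show ¬ (j : ℕ) + 1 ≤ b by omega),
          Finset.sum_const_zero]
    rw [Finset.sum_congr rfl fun b _ => hL b, Finset.sum_comm]
    refine Finset.sum_congr rfl fun c _ => ?_
    have hY : ∀ g : Equiv.Perm (Fin n) → ℤ, ∀ s t, x ≠ s → x ≠ t → ∀ v, v = u * Equiv.swap s t →
        rowOp n (j + 1) p g v =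
          (∑ b : Fin n, if (j : ℕ) + 1 ≤ (b : ℕ) then bruhatOp x b g else 0) v := by
      intro g s t hs ht v hv
      have hvx : (v x : ℕ) = p := by rw [hv, mul_swap_apply_of_ne u hs ht, hx']
      rw [rowOp_apply g hvx, if_pos hxj2, Finset.sum_apply]
      refine Finset.sum_congr rfl fun b _ => ?_
      split_ifs <;> rfl
    have hpush : ∀ (s t : Fin n) (g : Fin n → Equiv.Perm (Fin n) → ℤ),
        bruhatOp s t (∑ b : Fin n, if (j : ℕ) + 1 ≤ (b : ℕ) then g b else 0) u =
        ∑ b : Fin n, if (j : ℕ) + 1 ≤ (b : ℕ) then bruhatOp s t (g b) u else 0 := by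
      intro s t g
      rw [map_sum, Finset.sum_apply]
      refine Finset.sum_congr rfl fun b _ => ?_
      split_ifs
      · rfl
      · rw [map_zero]; rfl
    rw [dunklTerm_apply]
    rcases eq_or_ne c x with rfl | hcx
    · simp only [if_true]
      have h1 : bruhatOp j c (rowOp n (j + 1) p f) u = 0 :=
        bruhatOp_eq_zero fun hc => absurd hc.1 hxj.asymm
      have h2 : bruhatOp c j (rowOp n (j + 1) p f) u =
          bruhatOp c j (∑ b : Fin n, if (j : ℕ) + 1 ≤ (b : ℕ) then bruhatOp j b f else 0) u := by
        refine bruhatOp_congr fun _ => ?_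
        rw [rowOp_apply (x := j) f (by rw [mul_swap_apply_right, hx']),
          if_pos (Nat.lt_succ_self _), Finset.sum_apply]
        refine Finset.sum_congr rfl fun b _ => ?_
        split_ifs <;> rfl
      rw [h1, h2, hpush, if_pos hx'.ge, ite_self, zero_sub, ← Finset.sum_neg_distrib]
      refine Finset.sum_congr rfl fun b _ => ?_
      split_ifs <;> simp
    · simp only [if_neg hcx]
      have h1 : bruhatOp j c (rowOp n (j + 1) p f) u = bruhatOp j c
          (∑ b : Fin n, if (j : ℕ) + 1 ≤ (b : ℕ) then bruhatOp x b f else 0) u :=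
        bruhatOp_congr fun _ => hY f j c hxj.ne hcx.symm _ rfl
      have h2 : bruhatOp c j (rowOp n (j + 1) p f) u = bruhatOp c j
          (∑ b : Fin n, if (j : ℕ) + 1 ≤ (b : ℕ) then bruhatOp x b f else 0) u :=
        bruhatOp_congr fun _ => hY f c j hcx.symm hxj.ne _ rfl
      rw [h1, h2, hpush, hpush]
      split_ifs <;> simp [← Finset.sum_sub_distrib, ← Finset.sum_neg_distrib] <;>
        refine Finset.sum_congr rfl fun b _ => ?_ <;> split_ifs <;> simp
  · have hxj1 : ¬ (x : ℕ) < j := hxj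
    rw [if_neg hxj1]
    symm
    refine Finset.sum_eq_zero fun c _ => ?_
    have hvan : ∀ (v : Equiv.Perm (Fin n)) (y : Fin n), (v y : ℕ) = p → j < y →
        rowOp n (j + 1) p f v = 0 := by
      intro v y hy hjy
      have : (j : ℕ) < y := hjy
      rw [rowOp_apply f hy, if_neg (by omega)]
    have h1 : (if p ≤ (u j : ℕ) then bruhatOp j c (rowOp n (j + 1) p f) u else 0) = 0 := by
      split_ifs with hpj
      · refine bruhatOp_eq_zero fun hc => ?_
        rcases eq_or_ne x j with rfl | hne
        · exact hvan _ c (by rw [mul_swap_apply_right, hx']) hc.1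
        · have hcx : x ≠ c := by
            rintro rfl
            have : (u j : ℕ) < u x := hc.2.1
            omega
          exact hvan _ x (by rw [mul_swap_apply_of_ne u hne hcx, hx'])
            (lt_of_le_of_ne (not_lt.1 hxj) hne.symm)
      · rfl
    have h2 : (if p ≤ (u c : ℕ) then bruhatOp c j (rowOp n (j + 1) p f) u else 0) = 0 := by
      split_ifs with hpc
      · refine bruhatOp_eq_zero fun hc => ?_
        have hlt : (u c : ℕ) < u j := hc.2.1
        have hne : x ≠ j := by
          rintro rfl
          omega
        have hcx : x ≠ c := by
          rintro rfl
          exact hxj hc.1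
        exact hvan _ x (by rw [mul_swap_apply_of_ne u hcx hne, hx'])
          (lt_of_le_of_ne (not_lt.1 hxj) hne.symm)
      · rfl
    rw [dunklTerm_apply, h1, h2, sub_zero]

/-- There is an increasing `k`-chain of length `d` from `u` to `w` all of whose smaller swapped
values are at least `p`. -/
def IncChainFrom {n : ℕ} (k : ℕ) : ℕ → ℕ → Equiv.Perm (Fin n) → Equiv.Perm (Fin n) → Prop
  | 0, _, u, w => u = w
  | d + 1, p, u, w => ∃ a b : Fin n, (a : ℕ) < k ∧ k ≤ (b : ℕ) ∧ BruhatCov u a b ∧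
      p ≤ (u a : ℕ) ∧ IncChainFrom k d ((u a : ℕ) + 1) (u * Equiv.swap a b) w

theorem IncChainFrom.apply_eq {n k : ℕ} {d p : ℕ} {u w : Equiv.Perm (Fin n)}
    (h : IncChainFrom k d p u w) {x : Fin n} (hx : (u x : ℕ) < p) : w x = u x := by
  induction d generalizing p u with
  | zero => rw [show u = w from h]
  | succ d ih =>
    obtain ⟨a, b, -, -, hc, hp, h⟩ := h
    have hab : (u a : ℕ) < u b := hc.2.1
    have hv : (u * Equiv.swap a b) x = u x := by
      apply mul_swap_apply_of_ne
      · rintro rfl; omega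
      · rintro rfl; omega
    rw [← hv]
    exact ih h (by rw [hv]; omega)

theorem incChainFrom_succ_iff {n k d p : ℕ} {u w : Equiv.Perm (Fin n)} :
    IncChainFrom k (d + 1) p u w ↔ IncChainFrom k (d + 1) (p + 1) u w ∨
      ∃ a b : Fin n, (a : ℕ) < k ∧ k ≤ (b : ℕ) ∧ BruhatCov u a b ∧ (u a : ℕ) = p ∧
        IncChainFrom k d (p + 1) (u * Equiv.swap a b) w := by
  constructor
  · rintro ⟨a, b, h1, h2, h3, h4, h5⟩
    rcases h4.eq_or_lt with h | h
    · exact Or.inr ⟨a, b, h1, h2, h3, h.symm, h ▸ h5⟩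
    · exact Or.inl ⟨a, b, h1, h2, h3, h, h5⟩
  · rintro (⟨a, b, h1, h2, h3, h4, h5⟩ | ⟨a, b, h1, h2, h3, rfl, h5⟩)
    · exact ⟨a, b, h1, h2, h3, by omega, h5⟩
    · exact ⟨a, b, h1, h2, h3, le_rfl, h5⟩

open Classical in
/-- Sum over the increasing `k`-chains of length `d` with smaller swapped values at least `p`. -/
noncomputable def incChainOp (n k d p : ℕ) : Module.End ℤ (Equiv.Perm (Fin n) → ℤ) where
  toFun f u := ∑ w, if IncChainFrom k d p u w then f w else 0
  map_add' f g := by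
    ext u
    simp only [Pi.add_apply, ← Finset.sum_add_distrib]
    refine Finset.sum_congr rfl fun w _ => ?_
    split_ifs <;> simp
  map_smul' c f := by
    ext u
    simp [Finset.mul_sum]

open Classical in
theorem incChainOp_apply {n k d p : ℕ} (f : Equiv.Perm (Fin n) → ℤ) (u : Equiv.Perm (Fin n)) :
    incChainOp n k d p f u = ∑ w, if IncChainFrom k d p u w then f w else 0 := rfl

theorem incChainOp_zero {n k p : ℕ} : incChainOp n k 0 p = 1 := by
  refine LinearMap.ext fun f => funext fun u => ?_
  rw [incChainOp_apply, Finset.sum_eq_single u]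
  · exact if_pos rfl
  · exact fun w _ h => if_neg fun h' => h (Eq.symm h')
  · simp

theorem incChainOp_of_le {n k d p : ℕ} (hp : n ≤ p) : incChainOp n k (d + 1) p = 0 := by
  refine LinearMap.ext fun f => funext fun u => ?_
  rw [incChainOp_apply]
  refine Finset.sum_eq_zero fun w _ => if_neg ?_
  rintro ⟨a, -, -, -, -, h, -⟩
  have := (u a).isLt
  omega

theorem incChainOp_self {n d p : ℕ} : incChainOp n n (d + 1) p = 0 := by
  refine LinearMap.ext fun f => funext fun u => ?_
  rw [incChainOp_apply]
  refine Finset.sum_eq_zero fun w _ => if_neg ?_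
  rintro ⟨-, b, -, h, -⟩
  have := b.isLt
  omega

theorem incChainOp_succ {n k d p : ℕ} (hp : p < n) :
    incChainOp n k (d + 1) p =
      incChainOp n k (d + 1) (p + 1) + rowOp n k p * incChainOp n k d (p + 1) := by
  classical
  refine LinearMap.ext fun f => funext fun u => ?_
  obtain ⟨x, hx⟩ := u.surjective ⟨p, hp⟩
  have hx' : (u x : ℕ) = p := by rw [hx]
  simp only [LinearMap.add_apply, Pi.add_apply, Module.End.mul_apply]
  have hrow : rowOp n k p (incChainOp n k d (p + 1) f) u = ∑ w, ∑ b : Fin n,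
      if ((x : ℕ) < k ∧ k ≤ (b : ℕ) ∧ BruhatCov u x b ∧
        IncChainFrom k d (p + 1) (u * Equiv.swap x b) w) then f w else 0 := by
    rw [rowOp_apply _ hx', Finset.sum_comm]
    by_cases h1 : (x : ℕ) < k
    · simp only [h1, if_true, true_and]
      refine Finset.sum_congr rfl fun b _ => ?_
      by_cases h2 : k ≤ (b : ℕ)
      · by_cases h3 : BruhatCov u x b
        · simp [bruhatOp_apply, incChainOp_apply, h2, h3]
        · simp [bruhatOp_apply, h3]
      · simp [h2]
    · simp [h1]
  rw [hrow, incChainOp_apply, incChainOp_apply, ← Finset.sum_add_distrib]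
  refine Finset.sum_congr rfl fun w _ => ?_
  have hb : ∀ b, IncChainFrom k d (p + 1) (u * Equiv.swap x b) w → b = w⁻¹ (u x) := by
    intro b h
    have h1 : ((u * Equiv.swap x b) b : ℕ) < p + 1 := by
      rw [mul_swap_apply_right, hx']; omega
    have h2 := h.apply_eq h1
    rw [mul_swap_apply_right] at h2
    simp [← h2]
  rw [Finset.sum_eq_single (w⁻¹ (u x))]
  · have hiff : IncChainFrom k (d + 1) p u w ↔ IncChainFrom k (d + 1) (p + 1) u w ∨
        ((x : ℕ) < k ∧ k ≤ ((w⁻¹ (u x) : Fin n) : ℕ) ∧ BruhatCov u x (w⁻¹ (u x)) ∧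
        IncChainFrom k d (p + 1) (u * Equiv.swap x (w⁻¹ (u x))) w) := by
      rw [incChainFrom_succ_iff]
      refine or_congr_right ⟨?_, fun ⟨h1, h2, h3, h4⟩ => ⟨x, _, h1, h2, h3, hx', h4⟩⟩
      rintro ⟨a, b, h1, h2, h3, h4, h5⟩
      obtain rfl : a = x := u.injective (Fin.ext (h4.trans hx'.symm))
      obtain rfl := hb b h5
      exact ⟨h1, h2, h3, h5⟩
    have hexcl : ¬ (IncChainFrom k (d + 1) (p + 1) u w ∧ BruhatCov u x (w⁻¹ (u x))) := by
      rintro ⟨h1, h2⟩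
      have h3 := h1.apply_eq (x := x) (by omega)
      have h4 : w⁻¹ (u x) = x := by simp [← h3]
      exact h2.1.ne h4.symm
    grind
  · intro b _ hne
    exact if_neg fun h => hne (hb b h.2.2.2)
  · simp

theorem incChainOp_succ_eq {n d p : ℕ} (j : Fin n) (hp : p ≤ n) :
    incChainOp n j (d + 1) p =
      incChainOp n (j + 1) (d + 1) p - dunklFrom j p * incChainOp n (j + 1) d p := by
  induction hp using Nat.decreasingInduction generalizing d with
  | self => simp [incChainOp_of_le le_rfl, dunklFrom_of_le j le_rfl]
  | of_succ p hp ih =>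
    have hsub := rowOp_succ_sub j hp
    have hmul := rowOp_mul_dunklFrom j hp
    rw [incChainOp_succ hp, incChainOp_succ hp, ih]
    rw [sub_eq_iff_eq_add] at hsub
    rcases d with _ | d
    · simp only [incChainOp_zero, mul_one]
      rw [hsub]
      abel
    · rw [ih, incChainOp_succ (k := j + 1) (d := d) hp]
      simp only [mul_sub, mul_add, ← mul_assoc, hmul]
      rw [hsub]
      noncomm_ring

theorem incChainOp_commute_of_dunklOp {n k : ℕ} (hk : k ≤ n) (d : ℕ)
    {y : Module.End ℤ (Equiv.Perm (Fin n) → ℤ)} (hy : ∀ j : Fin n, Commute (dunklOp j) y) :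
    Commute (incChainOp n k d 0) y := by
  induction hk using Nat.decreasingInduction generalizing d with
  | self =>
    rcases d with _ | d
    · rw [incChainOp_zero]; exact Commute.one_left y
    · rw [incChainOp_self]; exact Commute.zero_left y
  | of_succ k hk ih =>
    rcases d with _ | d
    · rw [incChainOp_zero]; exact Commute.one_left y
    · have := incChainOp_succ_eq (d := d) (p := 0) ⟨k, hk⟩ (Nat.zero_le n)
      rw [dunklFrom_zero] at this
      rw [this]
      exact (ih (d + 1)).sub_left ((hy _).mul_left (ih d))

theorem incChainOp_commute {n k l : ℕ} (hk : k ≤ n) (hl : l ≤ n) (d e : ℕ) :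
    Commute (incChainOp n k d 0) (incChainOp n l e 0) :=
  incChainOp_commute_of_dunklOp hk d fun i =>
    (incChainOp_commute_of_dunklOp hl e fun j => dunklOp_commute j i).symm

theorem exists_isIncKChain_iff {n k d p : ℕ} {u w : Equiv.Perm (Fin n)} :
    (∃ (v : Fin (d + 1) → Equiv.Perm (Fin n)) (a b : Fin d → Fin n), IsIncKChain n k v a b ∧
      v 0 = u ∧ v (Fin.last d) = w ∧ ∀ m, p ≤ (v m.castSucc (a m) : ℕ)) ↔
      IncChainFrom k d p u w := by
  induction d generalizing p u with
  | zero =>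
    constructor
    · rintro ⟨v, a, b, -, rfl, h, -⟩
      exact h
    · rintro h
      exact ⟨fun _ => u, Fin.elim0, Fin.elim0, ⟨fun m => m.elim0, fun m => m.elim0⟩, rfl, h,
        fun m => m.elim0⟩
  | succ d ih =>
    constructor
    · rintro ⟨v, a, b, ⟨hc, hinc⟩, rfl, hw, hp⟩
      obtain ⟨h1, h2, h3, h4⟩ := hc 0
      have hab : a 0 < b 0 := by
        have : (a 0 : ℕ) < b 0 := by omega
        exact this
      have h3' : v (Fin.succ 0) = v 0 * Equiv.swap (a 0) (b 0) := by
        rw [show v 0 = _ from h3, mul_assoc, Equiv.swap_mul_self, mul_one]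
      refine ⟨a 0, b 0, h1, h2, ?_, hp 0, ?_⟩
      · rw [bruhatCov_iff _ hab, ← h3']
        exact h4
      · rw [← ih]
        exact ⟨fun m => v m.succ, fun m => a m.succ, fun m => b m.succ,
          ⟨fun m => hc m.succ, fun m m' h => hinc m.succ m'.succ (Fin.succ_lt_succ_iff.2 h)⟩,
          h3', hw, fun m => hinc 0 m.succ (Fin.succ_pos m)⟩
    · rintro ⟨a0, b0, h1, h2, h3, h4, h5⟩
      rw [← ih] at h5
      obtain ⟨v, a, b, ⟨hc, hinc⟩, hv, hw, hp⟩ := h5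
      have h6 := (bruhatCov_iff u h3.1).1 h3
      refine ⟨Fin.cons u v, Fin.cons a0 a, Fin.cons b0 b, ⟨?_, ?_⟩, rfl, ?_, ?_⟩
      · intro m
        refine Fin.cases ?_ (fun m => ?_) m
        · simp only [Fin.cons_zero, Fin.castSucc_zero, Fin.cons_succ, hv]
          refine ⟨h1, h2, ?_, h6⟩
          rw [mul_assoc, Equiv.swap_mul_self, mul_one]
        · simpa only [Fin.cons_succ, Fin.castSucc_succ] using hc m
      · intro m m'
        refine Fin.cases ?_ (fun m => ?_) m
        · refine Fin.cases (fun h => absurd h (lt_irrefl _)) (fun m' _ => ?_) m'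
          simp only [Fin.cons_succ, Fin.castSucc_succ, Fin.cons_zero, Fin.castSucc_zero]
          exact hp m'
        · refine Fin.cases (fun h => absurd h (Fin.not_lt_zero _)) (fun m' h => ?_) m'
          simp only [Fin.cons_succ, Fin.castSucc_succ]
          exact hinc m m' (Fin.succ_lt_succ_iff.1 h)
      · rw [← Fin.succ_last, Fin.cons_succ, hw]
      · intro m
        refine Fin.cases ?_ (fun m => ?_) m
        · simpa using h4
        · simp only [Fin.cons_succ, Fin.castSucc_succ]
          have := hp m
          omega

theorem exIncKChainLen_iff {n k d : ℕ} {u w : Equiv.Perm (Fin n)} :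
    ExIncKChainLen n k d u w ↔ IncChainFrom k d 0 u w := by
  rw [← exists_isIncKChain_iff]
  simp [ExIncKChainLen]

theorem card_exIncKChainLen {n k l d e : ℕ} (u w : Equiv.Perm (Fin n)) :
    (Nat.card {v : Equiv.Perm (Fin n) //
      ExIncKChainLen n k d u v ∧ ExIncKChainLen n l e v w} : ℤ) =
    (incChainOp n k d 0 * incChainOp n l e 0) (Pi.single w 1) u := by
  classical
  rw [Nat.card_eq_fintype_card, Fintype.card_subtype, Finset.card_filter]
  push_cast
  simp only [Module.End.mul_apply, incChainOp_apply, exIncKChainLen_iff, Pi.single_apply, ite_and]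
  refine Finset.sum_congr rfl fun v _ => ?_
  split_ifs with h1 h2
  · rw [Finset.sum_eq_single w] <;> simp +contextual [h2]
  · symm
    refine Finset.sum_eq_zero fun x _ => ?_
    grind
  · rfl

theorem stmt13 (n k1 k2 d1 d2 : ℕ) (hk1 : 1 ≤ k1) (hk1' : k1 ≤ n - 1)
    (hk2 : 1 ≤ k2) (hk2' : k2 ≤ n - 1)
    (u w : Equiv.Perm (Fin n)) :
    Nat.card {v : Equiv.Perm (Fin n) //
        ExIncKChainLen n k1 d1 u v ∧ ExIncKChainLen n k2 d2 v w} =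
      Nat.card {v : Equiv.Perm (Fin n) //
        ExIncKChainLen n k2 d2 u v ∧ ExIncKChainLen n k1 d1 v w} := by
  have hcomm := incChainOp_commute (n := n) (k := k1) (l := k2) (by omega) (by omega) d1 d2
  rw [← Nat.cast_inj (R := ℤ), card_exIncKChainLen, card_exIncKChainLen, hcomm.eq]
end

section
/- For any w ∈ Sₙ and i ∈ [n-1], the divided difference operator satisfies ∂_i(𝔖_w) = 𝔖_{w·s_i} if w(i) > w(i+1), and ∂_i(𝔖_w) = 0 if w(i) < w(i+1), where Schubert polynomials are defined by 𝔖_{w₀} = x₁^{n-1}x₂^{n-2}⋯x_{n-1} and descending induction via ∂_i. -/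
/-- Position `i` (0-indexed) as an element of `Fin n`. -/
def pos0 (n : ℕ) (i : Fin (n - 1)) : Fin n :=
  ⟨(i : ℕ), by have := i.isLt; omega⟩

/-- Position `i + 1` (0-indexed) as an element of `Fin n`. -/
def pos1 (n : ℕ) (i : Fin (n - 1)) : Fin n :=
  ⟨(i : ℕ) + 1, by have := i.isLt; omega⟩

namespace Schubert

open MvPolynomial Equiv

section DividedDifference

variable {σ : Type*}

lemma X_sub_X_ne_zero {p q : σ} (h : p ≠ q) : (X p - X q : MvPolynomial σ ℚ) ≠ 0 :=
  sub_ne_zero.2 fun e => h (X_injective e)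

variable [DecidableEq σ]

lemma swap_braid {p q r : σ} (hpq : p ≠ q) (hqr : q ≠ r) (hpr : p ≠ r) :
    swap p q * swap q r * swap p q = swap q r * swap p q * swap q r := by
  rw [swap_mul_swap_mul_swap hpq hpr, swap_comm p q, swap_comm q r,
    swap_mul_swap_mul_swap hqr.symm hpr.symm, swap_comm p r]

lemma X_sub_X_dvd_sub_rename_swap (p q : σ) (f : MvPolynomial σ ℚ) :
    (X p - X q : MvPolynomial σ ℚ) ∣ f - rename (swap p q) f := by
  induction f using MvPolynomial.induction_on with
  | C a => simp
  | add f g hf hg =>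
    have h := dvd_add hf hg
    rwa [map_add, add_sub_add_comm]
  | mul_X f k hf =>
    have hk : (X p - X q : MvPolynomial σ ℚ) ∣ X k - X (swap p q k) := by
      rcases eq_or_ne k p with rfl | hp
      · simp
      rcases eq_or_ne k q with rfl | hq
      · rw [swap_apply_right, ← neg_sub, neg_dvd]
      · simp [swap_apply_of_ne_of_ne hp hq]
    have h := dvd_add (hf.mul_right (X k)) (hk.mul_left (rename (swap p q) f))
    rw [map_mul, rename_X]
    convert h using 1
    ring

/-- The divided difference operator `(f - s f) / (X p - X q)`, with `s` the swap of `p` and `q`. -/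
noncomputable def dividedDiff (p q : σ) (f : MvPolynomial σ ℚ) : MvPolynomial σ ℚ :=
  (X_sub_X_dvd_sub_rename_swap p q f).choose

lemma mul_dividedDiff (p q : σ) (f : MvPolynomial σ ℚ) :
    (X p - X q) * dividedDiff p q f = f - rename (swap p q) f :=
  (X_sub_X_dvd_sub_rename_swap p q f).choose_spec.symm

lemma rename_mul_dividedDiff (e : Perm σ) (p q : σ) (f : MvPolynomial σ ℚ) :
    (X (e p) - X (e q)) * rename e (dividedDiff p q f) =
      rename e f - rename e (rename (swap p q) f) := by
  simpa using congrArg (rename e) (mul_dividedDiff p q f)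

lemma rename_swap_rename_swap (p q : σ) (f : MvPolynomial σ ℚ) :
    rename (swap p q) (rename (swap p q) f) = f := by
  rw [rename_rename, ← coe_trans, swap_swap]
  simp

lemma rename_swap_dividedDiff {p q : σ} (h : p ≠ q) (f : MvPolynomial σ ℚ) :
    rename (swap p q) (dividedDiff p q f) = dividedDiff p q f := by
  apply mul_left_cancel₀ (X_sub_X_ne_zero h)
  have h₁ := mul_dividedDiff p q f
  have h₂ := rename_mul_dividedDiff (swap p q) p q f
  rw [rename_swap_rename_swap, swap_apply_left, swap_apply_right] at h₂
  linear_combination -h₁ - h₂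

lemma dividedDiff_comm {p q r s : σ} (hpq : p ≠ q) (hrs : r ≠ s)
    (hpr : p ≠ r) (hps : p ≠ s) (hqr : q ≠ r) (hqs : q ≠ s) (f : MvPolynomial σ ℚ) :
    dividedDiff p q (dividedDiff r s f) = dividedDiff r s (dividedDiff p q f) := by
  apply mul_left_cancel₀ (mul_ne_zero (X_sub_X_ne_zero hpq) (X_sub_X_ne_zero hrs))
  have h₁ := mul_dividedDiff r s f
  have h₂ := rename_mul_dividedDiff (swap p q) r s f
  have h₃ := mul_dividedDiff p q (dividedDiff r s f)
  have k₁ := mul_dividedDiff p q f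
  have k₂ := rename_mul_dividedDiff (swap r s) p q f
  have k₃ := mul_dividedDiff r s (dividedDiff p q f)
  rw [swap_apply_of_ne_of_ne hpr.symm hqr.symm, swap_apply_of_ne_of_ne hps.symm hqs.symm] at h₂
  rw [swap_apply_of_ne_of_ne hpr hps, swap_apply_of_ne_of_ne hqr hqs] at k₂
  have comm : rename (swap p q) (rename (swap r s) f) = rename (swap r s) (rename (swap p q) f) := by
    rw [rename_rename, rename_rename, ← Perm.coe_mul, ← Perm.coe_mul,
      (Perm.disjoint_swap_swap (by simp [*])).commute.eq]
  linear_combination (X r - X s) * h₃ + h₁ - h₂ - (X p - X q) * k₃ - k₁ + k₂ + comm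

lemma dividedDiff_braid {p q r : σ} (hpq : p ≠ q) (hqr : q ≠ r) (hpr : p ≠ r)
    (f : MvPolynomial σ ℚ) :
    dividedDiff p q (dividedDiff q r (dividedDiff p q f)) =
      dividedDiff q r (dividedDiff p q (dividedDiff q r f)) := by
  apply mul_left_cancel₀ (mul_ne_zero (mul_ne_zero (X_sub_X_ne_zero hpq) (X_sub_X_ne_zero hqr))
    (X_sub_X_ne_zero hpr))
  have sp : swap q r p = p := swap_apply_of_ne_of_ne hpq hpr
  have sr : swap p q r = r := swap_apply_of_ne_of_ne hpr.symm hqr.symm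
  have h₁ := mul_dividedDiff p q f
  have h₂ := rename_mul_dividedDiff (swap q r) p q f
  have h₃ := congrArg (rename (swap p q)) h₂
  have h₄ := mul_dividedDiff q r (dividedDiff p q f)
  have h₅ := rename_mul_dividedDiff (swap p q) q r (dividedDiff p q f)
  have h₆ := mul_dividedDiff p q (dividedDiff q r (dividedDiff p q f))
  have k₁ := mul_dividedDiff q r f
  have k₂ := rename_mul_dividedDiff (swap p q) q r f
  have k₃ := congrArg (rename (swap q r)) k₂
  have k₄ := mul_dividedDiff p q (dividedDiff q r f)
  have k₅ := rename_mul_dividedDiff (swap q r) p q (dividedDiff q r f)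
  have k₆ := mul_dividedDiff q r (dividedDiff p q (dividedDiff q r f))
  rw [rename_swap_dividedDiff hpq] at h₅
  rw [rename_swap_dividedDiff hqr] at k₅
  simp only [map_mul, map_sub, rename_X, swap_apply_left, swap_apply_right, sp, sr]
    at h₂ h₃ h₅ k₂ k₃ k₅
  have braid : rename (swap p q) (rename (swap q r) (rename (swap p q) f)) =
      rename (swap q r) (rename (swap p q) (rename (swap q r) f)) := by
    simp only [rename_rename, ← Perm.coe_mul, ← mul_assoc, swap_braid hpq hqr hpr]
  linear_combination (X q - X r) * (X p - X r) * h₆ + (X p - X r) * h₄ - (X q - X r) * h₅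
    + h₁ - h₂ + h₃
    - ((X p - X q) * (X p - X r) * k₆ + (X p - X r) * k₄ - (X p - X q) * k₅
    + k₁ - k₂ + k₃) - braid

end DividedDifference

variable {n : ℕ}

lemma pos0_lt_pos1 (i : Fin (n - 1)) : pos0 n i < pos1 n i := by
  simp [pos0, pos1, Fin.lt_def]

/-- The permutation `w` composed with the adjacent transposition at positions `i`, `i + 1`. -/
abbrev mulAdj (w : Perm (Fin n)) (i : Fin (n - 1)) : Perm (Fin n) :=
  w * swap (pos0 n i) (pos1 n i)

/-- The sum `∑ k, k * w k`, which drops when an ascent is turned into a descent. -/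
def weight (w : Perm (Fin n)) : ℕ := ∑ k : Fin n, (k : ℕ) * (w k : ℕ)

lemma weight_mul_swap_lt {w : Perm (Fin n)} {p q : Fin n} (hpq : p < q) (h : w p < w q) :
    weight (w * swap p q) < weight w := by
  have key (v : Perm (Fin n)) : weight v = (p : ℕ) * v p + ((q : ℕ) * v q +
      ∑ k ∈ (Finset.univ.erase p).erase q, (k : ℕ) * (v k : ℕ)) := by
    rw [Finset.add_sum_erase _ (fun k : Fin n => (k : ℕ) * (v k : ℕ)) (by simp [hpq.ne']),
      Finset.add_sum_erase _ (fun k : Fin n => (k : ℕ) * (v k : ℕ)) (Finset.mem_univ p), weight]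
  have rest : ∑ k ∈ (Finset.univ.erase p).erase q, (k : ℕ) * ((w * swap p q) k : ℕ) =
      ∑ k ∈ (Finset.univ.erase p).erase q, (k : ℕ) * (w k : ℕ) := by
    refine Finset.sum_congr rfl fun k hk => ?_
    simp only [Finset.mem_erase] at hk
    rw [Perm.mul_apply, swap_apply_of_ne_of_ne hk.2.1 hk.1]
  rw [key w, key, rest, Perm.mul_apply, Perm.mul_apply, swap_apply_left, swap_apply_right]
  rw [Fin.lt_def] at hpq h
  nlinarith

open Classical in
/-- Schubert polynomials, computed by descending along arbitrarily chosen ascents. -/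
noncomputable def schubert (w : Perm (Fin n)) : MvPolynomial (Fin n) ℚ :=
  if h : ∃ i, w (pos0 n i) < w (pos1 n i) then
    dividedDiff (pos0 n h.choose) (pos1 n h.choose) (schubert (mulAdj w h.choose))
  else ∏ i : Fin n, X i ^ (n - 1 - (i : ℕ))
termination_by weight w
decreasing_by exact weight_mul_swap_lt (pos0_lt_pos1 _) h.choose_spec

/-- The value of `schubert w` may be computed from the ascent `i` of `w`. -/
def AscentRule (w : Perm (Fin n)) (i : Fin (n - 1)) : Prop :=
  w (pos0 n i) < w (pos1 n i) →
    schubert w = dividedDiff (pos0 n i) (pos1 n i) (schubert (mulAdj w i))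

lemma dividedDiff_schubert_eq_of_lt {w : Perm (Fin n)}
    (ih : ∀ v : Perm (Fin n), weight v < weight w → ∀ i, AscentRule v i)
    {i j : Fin (n - 1)} (hij : i < j) (hi : w (pos0 n i) < w (pos1 n i))
    (hj : w (pos0 n j) < w (pos1 n j)) :
    dividedDiff (pos0 n i) (pos1 n i) (schubert (mulAdj w i)) =
      dividedDiff (pos0 n j) (pos1 n j) (schubert (mulAdj w j)) := by
  have wi := weight_mul_swap_lt (pos0_lt_pos1 i) hi
  have wj := weight_mul_swap_lt (pos0_lt_pos1 j) hj
  have ihi := ih _ wi j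
  have ihj := ih _ wj i
  have hpq := pos0_lt_pos1 i
  have hrs := pos0_lt_pos1 j
  have hpr : pos0 n i < pos0 n j := hij
  have hqs : pos1 n i < pos1 n j := Nat.succ_lt_succ hij
  have hps := hpq.trans hqs
  rcases eq_or_ne (pos1 n i) (pos0 n j) with hqr | hqr
  · have ihij h := ih (mulAdj (mulAdj w i) j) h i
    have ihji h := ih (mulAdj (mulAdj w j) i) h j
    simp only [AscentRule, mulAdj] at ihi ihj ihij ihji wi wj ⊢
    clear ih
    generalize pos0 n i = p at *
    generalize pos1 n i = q at *
    generalize pos0 n j = q' at *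
    generalize pos1 n j = r at *
    subst hqr
    have sp : swap q r p = p := swap_apply_of_ne_of_ne hpq.ne hps.ne
    have sr : swap p q r = r := swap_apply_of_ne_of_ne hps.ne' hrs.ne'
    have hwpr := hi.trans hj
    have aij : (w * swap p q) q < (w * swap p q) r := by simpa [sr] using hwpr
    have aji : (w * swap q r) p < (w * swap q r) q := by simpa [sp] using hwpr
    rw [ihi aij, ihj aji,
      ihij ((weight_mul_swap_lt hrs aij).trans wi) (by simpa [sp, sr] using hj),
      ihji ((weight_mul_swap_lt hpq aji).trans wj) (by simpa [sp, sr] using hi),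
      dividedDiff_braid hpq.ne hrs.ne hps.ne, mul_assoc w, mul_assoc w, mul_assoc w, mul_assoc w,
      swap_braid hpq.ne hrs.ne hps.ne]
  · simp only [AscentRule, mulAdj, Perm.mul_apply] at ihi ihj ⊢
    rw [swap_apply_of_ne_of_ne hpr.ne' hqr.symm, swap_apply_of_ne_of_ne hps.ne' hqs.ne'] at ihi
    rw [swap_apply_of_ne_of_ne hpr.ne hps.ne, swap_apply_of_ne_of_ne hqr hqs.ne] at ihj
    rw [ihi hj, ihj hi, dividedDiff_comm hpq.ne hrs.ne hpr.ne hps.ne hqr hqs.ne, mul_assoc,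
      mul_assoc,
      (Perm.disjoint_swap_swap (by simp [hpq.ne, hpr.ne, hps.ne, hqr, hqs.ne, hrs.ne])).commute.eq]

lemma ascentRule (w : Perm (Fin n)) (i : Fin (n - 1)) : AscentRule w i := by
  induction hm : weight w using Nat.strong_induction_on generalizing w i with
  | _ m ih =>
    subst hm
    replace ih : ∀ v : Perm (Fin n), weight v < weight w → ∀ i, AscentRule v i :=
      fun v hv i => ih _ hv v i rfl
    intro hi
    have h : ∃ i, w (pos0 n i) < w (pos1 n i) := ⟨i, hi⟩
    rw [schubert, dif_pos h]
    rcases lt_trichotomy h.choose i with hlt | heq | hlt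
    · exact dividedDiff_schubert_eq_of_lt ih hlt h.choose_spec hi
    · rw [heq]
    · exact (dividedDiff_schubert_eq_of_lt ih hlt hi h.choose_spec).symm

lemma schubert_revPerm :
    schubert (Fin.revPerm : Perm (Fin n)) = ∏ i : Fin n, X i ^ (n - 1 - (i : ℕ)) := by
  rw [schubert, dif_neg]
  rintro ⟨i, hi⟩
  simp only [Fin.revPerm_apply, Fin.rev_lt_rev] at hi
  exact hi.asymm (pos0_lt_pos1 i)

end Schubert

theorem stmt15 (n : ℕ) :
    ∃ S : Equiv.Perm (Fin n) → MvPolynomial (Fin n) ℚ,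
      S Fin.revPerm = ∏ i : Fin n, MvPolynomial.X i ^ (n - 1 - (i : ℕ)) ∧
      ∀ (w : Equiv.Perm (Fin n)) (i : Fin (n - 1)),
        (w (pos1 n i) < w (pos0 n i) →
          (MvPolynomial.X (pos0 n i) - MvPolynomial.X (pos1 n i)) *
              S (w * Equiv.swap (pos0 n i) (pos1 n i)) =
            S w - MvPolynomial.rename (Equiv.swap (pos0 n i) (pos1 n i)) (S w)) ∧
        (w (pos0 n i) < w (pos1 n i) →
          MvPolynomial.rename (Equiv.swap (pos0 n i) (pos1 n i)) (S w) = S w) := by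
  refine ⟨Schubert.schubert, Schubert.schubert_revPerm, fun w i => ⟨fun h => ?_, fun h => ?_⟩⟩
  · have key := Schubert.ascentRule (Schubert.mulAdj w i) i (by simpa [Schubert.mulAdj] using h)
    rw [Schubert.mulAdj, Schubert.mulAdj, mul_assoc, Equiv.swap_mul_self, mul_one] at key
    rw [key, Schubert.mul_dividedDiff]
  · rw [Schubert.ascentRule w i h, Schubert.rename_swap_dividedDiff (Schubert.pos0_lt_pos1 i).ne]
end
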